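/- Let X be a T1 topological space, f : X → X a continuous map, and S ⊆ X a set such that every x ∈ S satisfies x ∉ closure{f^n(x) : n ≥ 1} (i.e., no point of S is periodic and no point of S lies in the closure of its own forward orbit shifted by one iterate). Define a relation ≺ on S by: x ≺ y if and only if x ≠ y and x ∈ closure{f^n(y) : n ≥ 0}. Then ≺ is a strict partial order on S: it is irreflexive and transitive (and hence asymmetric). -/

import Mathlib

theorem orbit_aux {X : Type*} [TopologicalSpace X] (f : X → X) (hf : Continuous f)
    (A : Set X) (hA : ∀ a ∈ A, f a ∈ A) (y : X) (hy : y ∈ closure A) :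
    closure {w | ∃ n : ℕ, f^[n] y = w} ⊆ closure A := by
  have hm : Set.MapsTo f (closure A) (closure A) := Set.MapsTo.closure hA hf
  apply closure_minimal _ isClosed_closure
  rintro w ⟨n, rfl⟩
  exact hm.iterate n hy

/-- Let `X` be a T1 space, `f : X → X` continuous, and `S ⊆ X` a set
such that every `x ∈ S` satisfies `x ∉ closure {f^n(x) : n ≥ 1}`.  Define `x ≺ y` iff
`x ≠ y` and `x ∈ closure {f^n(y) : n ≥ 0}`.  Then `≺` is a strict partial order on `S`:
irreflexive and transitive, hence asymmetric. -/
theorem orbit_closure_strict_partial_order {X : Type*} [TopologicalSpace X] [T1Space X]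
    (f : X → X) (hf : Continuous f) (S : Set X)
    (hS : ∀ x ∈ S, x ∉ closure {y | ∃ n ≥ 1, f^[n] x = y})
    (prec : X → X → Prop)
    (hprec : ∀ x y, prec x y ↔ x ≠ y ∧ x ∈ closure {w | ∃ n : ℕ, f^[n] y = w}) :
    (∀ x ∈ S, ¬ prec x x) ∧
      (∀ x ∈ S, ∀ y ∈ S, ∀ z ∈ S, prec x y → prec y z → prec x z) ∧
      (∀ x ∈ S, ∀ y ∈ S, prec x y → ¬ prec y x) := by
  have asym : ∀ x ∈ S, ∀ y ∈ S, prec x y → ¬ prec y x := by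
    intro x hx y _ hxy hyx
    obtain ⟨hne, h1⟩ := (hprec _ _).1 hxy
    obtain ⟨_, h2⟩ := (hprec _ _).1 hyx
    apply hS x hx
    refine orbit_aux f hf _ ?_ y ?_ h1
    · rintro a ⟨n, hn, rfl⟩
      exact ⟨n + 1, by omega, Function.iterate_succ_apply' f n x⟩
    · have hsub : {w | ∃ n : ℕ, f^[n] x = w} ⊆ {x} ∪ {y | ∃ n ≥ 1, f^[n] x = y} := by
        rintro w ⟨n, rfl⟩
        rcases n with _ | n
        · left; rfl
        · right; exact ⟨n + 1, by omega, rfl⟩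
      have h3 := closure_mono hsub h2
      rw [closure_union, closure_singleton] at h3
      rcases h3 with h3 | h3
      · exact absurd h3.symm hne
      · exact h3
  refine ⟨fun x _ h => ((hprec _ _).1 h).1 rfl, ?_, asym⟩
  intro x hx y hy z _ hxy hyz
  refine (hprec _ _).2 ⟨?_, ?_⟩
  · rintro rfl
    exact asym x hx y hy hxy hyz
  · refine orbit_aux f hf _ ?_ y ((hprec _ _).1 hyz).2 ((hprec _ _).1 hxy).2
    rintro a ⟨n, rfl⟩
    exact ⟨n + 1, Function.iterate_succ_apply' f n z⟩
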